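/- Let G and H be countable amenable groups and let A be a common finite subgroup of G and H. Then the amalgamated free product G ∗_A H belongs to the class 𝒜. -/

import Mathlib

/-- A `G`-invariant mean on `X`, for the `G`-action on `X` given by `φ`:
a finitely additive probability "measure" on the subsets of `X` invariant under `G`. -/
def IsInvariantMean {G X : Type*} [Group G] (φ : G →* Equiv.Perm X)
    (μ : Set X → ℝ) : Prop :=
  (∀ S : Set X, 0 ≤ μ S) ∧ μ Set.univ = 1 ∧
  (∀ S T : Set X, Disjoint S T → μ (S ∪ T) = μ S + μ T) ∧
  (∀ (g : G) (S : Set X), μ ((φ g) '' S) = μ S)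

/-- The action of `G` on `X` given by `φ` is amenable: there is a `G`-invariant mean on `X`. -/
def AmenableAction {G X : Type*} [Group G] (φ : G →* Equiv.Perm X) : Prop :=
  ∃ μ : Set X → ℝ, IsInvariantMean φ μ

/-- A group is amenable if its left-translation action on itself is amenable. -/
def AmenableGroup (G : Type*) [Group G] : Prop :=
  AmenableAction (MulAction.toPermHom G G)

/-- A group `G` is in the class `𝒜` if it admits a transitive, faithful and
amenable action on some countable set. -/
def InClassA (G : Type*) [Group G] : Prop :=
  ∃ (X : Type) (_ : Countable X) (φ : G →* Equiv.Perm X),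
    Function.Injective φ ∧ (∀ x y : X, ∃ g : G, φ g x = y) ∧ AmenableAction φ

/-- `(P, jG, jH)` is the amalgamated free product of `G` and `H` over `A`
(along the homomorphisms `iG : A →* G` and `iH : A →* H`), i.e. it is a pushout
of `iG` and `iH` in the category of groups. -/
def IsAmalgamatedProduct {A G H P : Type*} [Group A] [Group G] [Group H] [Group P]
    (iG : A →* G) (iH : A →* H) (jG : G →* P) (jH : H →* P) : Prop :=
  jG.comp iG = jH.comp iH ∧
  ∀ (L : Type) [Group L] (fG : G →* L) (fH : H →* L),
    fG.comp iG = fH.comp iH → ∃! f : P →* L, f.comp jG = fG ∧ f.comp jH = fH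

/-- A real-valued function is bounded. -/
def IsBoundedFun {X : Type*} (f : X → ℝ) : Prop := ∃ C : ℝ, ∀ x, |f x| ≤ C

namespace IsBoundedFun

variable {X Y : Type*} {f g : X → ℝ}

lemma comp (hf : IsBoundedFun f) (σ : Y → X) : IsBoundedFun (f ∘ σ) :=
  let ⟨C, hC⟩ := hf
  ⟨C, fun y => hC (σ y)⟩

lemma add (hf : IsBoundedFun f) (hg : IsBoundedFun g) : IsBoundedFun (f + g) :=
  let ⟨C, hC⟩ := hf
  let ⟨D, hD⟩ := hg
  ⟨C + D, fun x => (abs_add_le _ _).trans (add_le_add (hC x) (hD x))⟩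

lemma neg (hf : IsBoundedFun f) : IsBoundedFun (-f) :=
  let ⟨C, hC⟩ := hf
  ⟨C, fun x => by simpa using hC x⟩

lemma const (c : ℝ) : IsBoundedFun (fun _ : X => c) := ⟨|c|, fun _ => le_rfl⟩

lemma sum {ι : Type*} (s : Finset ι) {F : ι → X → ℝ} (hF : ∀ i, IsBoundedFun (F i)) :
    IsBoundedFun (∑ i ∈ s, F i) := by
  classical
  induction s using Finset.induction_on with
  | empty => exact const 0
  | insert i s hi ih => rw [Finset.sum_insert hi]; exact (hF i).add ih

lemma indicator_one (S : Set X) : IsBoundedFun (S.indicator (1 : X → ℝ)) := by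
  classical
  refine ⟨1, fun x => ?_⟩
  by_cases h : x ∈ S <;> simp [h]

end IsBoundedFun

/-- A mean, as an additive normalized functional on the bounded functions. -/
structure FunctionalMean (X : Type*) where
  /-- The underlying functional. -/
  toFun : (X → ℝ) → ℝ
  map_add' : ∀ {f g : X → ℝ}, IsBoundedFun f → IsBoundedFun g →
    toFun (f + g) = toFun f + toFun g
  le_of_le' : ∀ {f : X → ℝ} {C : ℝ}, IsBoundedFun f → (∀ x, f x ≤ C) → toFun f ≤ C

namespace FunctionalMean

variable {X Y : Type*}

instance : CoeFun (FunctionalMean X) (fun _ => (X → ℝ) → ℝ) := ⟨toFun⟩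

variable (M : FunctionalMean X) {f g : X → ℝ}

lemma map_add (hf : IsBoundedFun f) (hg : IsBoundedFun g) : M (f + g) = M f + M g :=
  M.map_add' hf hg

lemma le_of_le {C : ℝ} (hf : IsBoundedFun f) (h : ∀ x, f x ≤ C) : M f ≤ C :=
  M.le_of_le' hf h

lemma map_zero : M 0 = 0 := by
  have := M.map_add (IsBoundedFun.const (X := X) 0) (IsBoundedFun.const 0)
  have h : ((fun _ => 0 : X → ℝ) + fun _ => 0) = 0 := by ext; simp
  rw [h] at this
  change M 0 = M 0 + M 0 at this
  linarith

lemma map_neg (hf : IsBoundedFun f) : M (-f) = -M f := by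
  have := M.map_add hf hf.neg
  rw [add_neg_cancel, map_zero] at this
  linarith

lemma le_of_ge {C : ℝ} (hf : IsBoundedFun f) (h : ∀ x, C ≤ f x) : C ≤ M f := by
  have := M.le_of_le hf.neg (C := -C) (fun x => by simpa using h x)
  rw [M.map_neg hf] at this
  linarith

lemma map_const (c : ℝ) : M (fun _ => c) = c :=
  le_antisymm (M.le_of_le (.const c) fun _ => le_rfl) (M.le_of_ge (.const c) fun _ => le_rfl)

lemma abs_le {C : ℝ} (h : ∀ x, |f x| ≤ C) : |M f| ≤ C :=
  _root_.abs_le.2 ⟨M.le_of_ge ⟨C, h⟩ fun x => (_root_.abs_le.1 (h x)).1,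
    M.le_of_le ⟨C, h⟩ fun x => (_root_.abs_le.1 (h x)).2⟩

lemma map_sum {ι : Type*} (s : Finset ι) {F : ι → X → ℝ} (hF : ∀ i, IsBoundedFun (F i)) :
    M (∑ i ∈ s, F i) = ∑ i ∈ s, M (F i) := by
  classical
  induction s using Finset.induction_on with
  | empty => simpa using M.map_zero
  | insert i s hi ih =>
    rw [Finset.sum_insert hi, Finset.sum_insert hi, M.map_add (hF i) (IsBoundedFun.sum s hF), ih]

/-- The push-forward of a mean. -/
def map (σ : X → Y) : FunctionalMean Y where
  toFun f := M (f ∘ σ)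
  map_add' hf hg := M.map_add (hf.comp σ) (hg.comp σ)
  le_of_le' hf h := M.le_of_le (hf.comp σ) fun x => h (σ x)

lemma isBoundedFun_apply (N : FunctionalMean Y) {f : X × Y → ℝ} (hf : IsBoundedFun f) :
    IsBoundedFun fun x => N fun y => f (x, y) :=
  let ⟨C, hC⟩ := hf
  ⟨C, fun x => N.abs_le fun y => hC (x, y)⟩

/-- The iterated mean on a product. -/
def prod (N : FunctionalMean Y) : FunctionalMean (X × Y) where
  toFun f := M fun x => N fun y => f (x, y)
  map_add' {f g} hf hg := by
    rw [← M.map_add (N.isBoundedFun_apply hf) (N.isBoundedFun_apply hg)]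
    congr 1
    ext x
    exact N.map_add (hf.comp (Prod.mk x)) (hg.comp (Prod.mk x))
  le_of_le' hf h := M.le_of_le (N.isBoundedFun_apply hf) fun x =>
    N.le_of_le (hf.comp (Prod.mk x)) fun y => h (x, y)

/-- The mean is invariant under a permutation. -/
def IsInvariant (σ : Equiv.Perm X) : Prop := ∀ f, IsBoundedFun f → M (f ∘ σ) = M f

variable {M}

lemma IsInvariant.mul {σ τ : Equiv.Perm X} (hσ : M.IsInvariant σ) (hτ : M.IsInvariant τ) :
    M.IsInvariant (σ * τ) := fun f hf => by
  rw [Equiv.Perm.coe_mul, ← Function.comp_assoc, hτ _ (hf.comp σ), hσ f hf]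

lemma IsInvariant.inv {σ : Equiv.Perm X} (hσ : M.IsInvariant σ) : M.IsInvariant σ⁻¹ :=
  fun f hf => by
  rw [← hσ _ (hf.comp _), Function.comp_assoc, ← Equiv.Perm.coe_mul, inv_mul_cancel]
  rfl

variable (M)

/-- The permutations preserving a mean. -/
def stabilizer : Subgroup (Equiv.Perm X) where
  carrier := {σ | M.IsInvariant σ}
  mul_mem' := IsInvariant.mul
  one_mem' := fun _ _ => rfl
  inv_mem' := IsInvariant.inv

variable {M}

lemma amenableAction {P : Type*} [Group P] {ψ : P →* Equiv.Perm X}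
    (h : ∀ p, M.IsInvariant (ψ p)) : AmenableAction ψ := by
  classical
  refine ⟨fun S => M (S.indicator 1), fun S => ?_, ?_, fun S T hST => ?_, fun p S => ?_⟩
  · exact M.le_of_ge (.indicator_one S) fun x => Set.indicator_nonneg (fun _ _ => zero_le_one) x
  · beta_reduce
    rw [Set.indicator_univ]
    exact M.map_const 1
  · beta_reduce
    rw [← M.map_add (.indicator_one S) (.indicator_one T), Set.indicator_union_of_disjoint hST]
    rfl
  · beta_reduce
    rw [← h p _ (.indicator_one _)]
    congr 1
    ext x
    by_cases hx : x ∈ S <;> simp [Set.indicator, hx]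

end FunctionalMean

section Integration

open MeasureTheory

lemma exists_simpleFunc_integral {X : Type*} {μ : Set X → ℝ} (h0 : ∀ S, 0 ≤ μ S)
    (h1 : μ Set.univ = 1) (hadd : ∀ S T : Set X, Disjoint S T → μ (S ∪ T) = μ S + μ T) :
    letI : MeasurableSpace X := ⊤
    ∃ J : SimpleFunc X ℝ → ℝ, (∀ s t, J (s + t) = J s + J t) ∧ (∀ s t, s ≤ t → J s ≤ J t) ∧
      (∀ c, J (SimpleFunc.const X c) = c) ∧
      ∀ σ : Equiv.Perm X, (∀ S, μ (σ '' S) = μ S) →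
        ∀ s, J (s.comp σ measurable_from_top) = J s := by
  let _ : MeasurableSpace X := ⊤
  let T : Set X → ℝ →L[ℝ] ℝ := fun S => μ S • ContinuousLinearMap.id ℝ ℝ
  have hT : FinMeasAdditive (0 : Measure X) T := fun S S' _ _ _ _ h => by
    simp only [T, hadd S S' h, add_smul]
  have hs : ∀ s : SimpleFunc X ℝ, Integrable s (0 : Measure X) := fun s => integrable_zero_measure
  refine ⟨SimpleFunc.setToSimpleFunc T, fun s t => ?_, fun s t hst => ?_, fun c => ?_,
    fun σ hσ s => ?_⟩
  · exact SimpleFunc.setToSimpleFunc_add T hT (hs s) (hs t)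
  · exact SimpleFunc.setToSimpleFunc_mono hT
      (fun S _ _ x hx => by simpa [T] using mul_nonneg (h0 S) hx) (hs s) (hs t) hst
  · have : Nonempty X := by
      by_contra hX
      have hE : (Set.univ : Set X) = ∅ := Set.univ_eq_empty_iff.2 (not_nonempty_iff.1 hX)
      have := hadd ∅ ∅ (by simp)
      rw [Set.union_empty, ← hE] at this
      linarith
    have hc : Function.const X c ⁻¹' {c} = Set.univ := by ext; simp
    simp [SimpleFunc.setToSimpleFunc, T, hc, h1]
  · have hr : (s.comp σ measurable_from_top).range = s.range := by
      ext y
      simp only [SimpleFunc.mem_range, SimpleFunc.coe_comp, Set.mem_range]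
      exact ⟨fun ⟨x, hx⟩ => ⟨σ x, hx⟩, fun ⟨x, hx⟩ => ⟨σ⁻¹ x, by simpa using hx⟩⟩
    simp only [SimpleFunc.setToSimpleFunc, hr]
    refine Finset.sum_congr rfl fun y _ => ?_
    simp only [T]
    rw [← hσ (s.comp σ measurable_from_top ⁻¹' {y})]
    congr 3
    ext x
    simp only [Set.mem_image, Set.mem_preimage, SimpleFunc.coe_comp, Function.comp]
    exact ⟨fun ⟨z, hz, hzx⟩ => hzx ▸ hz, fun hx => ⟨σ⁻¹ x, by simpa using hx, by simp⟩⟩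

lemma exists_simpleFunc_approx {X : Type*} {f : X → ℝ} (hf : IsBoundedFun f) {ε : ℝ}
    (hε : 0 < ε) :
    letI : MeasurableSpace X := ⊤
    ∃ s : SimpleFunc X ℝ, ∀ x, s x ≤ f x ∧ f x ≤ s x + ε := by
  let _ : MeasurableSpace X := ⊤
  obtain ⟨C, hC⟩ := hf
  refine ⟨⟨fun x => ε * ⌊f x / ε⌋, fun _ => trivial, ?_⟩, fun x => ?_⟩
  · refine ((Set.finite_Icc (⌊-C / ε⌋) (⌊C / ε⌋)).image fun n : ℤ => ε * (n : ℝ)).subset ?_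
    rintro _ ⟨x, rfl⟩
    refine ⟨⌊f x / ε⌋, ⟨Int.floor_le_floor ?_, Int.floor_le_floor ?_⟩, rfl⟩
    · exact div_le_div_of_nonneg_right (abs_le.1 (hC x)).1 hε.le
    · exact div_le_div_of_nonneg_right (abs_le.1 (hC x)).2 hε.le
  · have h1 := Int.floor_le (f x / ε)
    have h2 := Int.lt_floor_add_one (f x / ε)
    have h3 : f x = ε * (f x / ε) := by field_simp
    constructor
    · change ε * (⌊f x / ε⌋ : ℝ) ≤ _
      nlinarith
    · change _ ≤ ε * (⌊f x / ε⌋ : ℝ) + ε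
      nlinarith

lemma exists_functionalMean {X : Type*} {μ : Set X → ℝ} (h0 : ∀ S, 0 ≤ μ S)
    (h1 : μ Set.univ = 1) (hadd : ∀ S T : Set X, Disjoint S T → μ (S ∪ T) = μ S + μ T) :
    ∃ M : FunctionalMean X,
      ∀ σ : Equiv.Perm X, (∀ S, μ (σ '' S) = μ S) → M.IsInvariant σ := by
  let _ : MeasurableSpace X := ⊤
  obtain ⟨J, Jadd, Jmono, Jconst, Jinv⟩ := exists_simpleFunc_integral h0 h1 hadd
  let I : (X → ℝ) → ℝ := fun f => sSup (J '' {s | ∀ x, s x ≤ f x})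
  have Jle : ∀ {s : SimpleFunc X ℝ} {f : X → ℝ}, IsBoundedFun f → (∀ x, s x ≤ f x) →
      J s ≤ I f := by
    rintro s f ⟨C, hC⟩ hs
    refine le_csSup ⟨C, ?_⟩ ⟨s, hs, rfl⟩
    rintro _ ⟨t, ht, rfl⟩
    rw [← Jconst C]
    exact Jmono _ _ fun x => (ht x).trans (abs_le.1 (hC x)).2
  have leJ : ∀ {s : SimpleFunc X ℝ} {f : X → ℝ}, IsBoundedFun f → (∀ x, f x ≤ s x) →
      I f ≤ J s := by
    rintro s f hf hs
    obtain ⟨t, ht⟩ := exists_simpleFunc_approx hf one_pos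
    refine csSup_le ⟨_, t, fun x => (ht x).1, rfl⟩ ?_
    rintro _ ⟨t, ht, rfl⟩
    exact Jmono _ _ fun x => (ht x).trans (hs x)
  refine ⟨⟨I, fun {f g} hf hg => ?_, fun {f C} hf h => ?_⟩, fun σ hσ f hf => ?_⟩
  · have key : ∀ ε > 0, |I (f + g) - (I f + I g)| ≤ 2 * ε := by
      intro ε hε
      obtain ⟨s, hs⟩ := exists_simpleFunc_approx hf hε
      obtain ⟨t, ht⟩ := exists_simpleFunc_approx hg hε
      have a1 := Jle hf fun x => (hs x).1
      have a2 := Jle hg fun x => (ht x).1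
      have a3 := leJ (s := s + .const X ε) hf fun x => (hs x).2
      have a4 := leJ (s := t + .const X ε) hg fun x => (ht x).2
      have a5 := Jle (s := s + t) (hf.add hg) fun x => add_le_add (hs x).1 (ht x).1
      have a6 := leJ (s := (s + .const X ε) + (t + .const X ε)) (hf.add hg)
        fun x => add_le_add (hs x).2 (ht x).2
      simp only [Jadd, Jconst] at a3 a4 a5 a6
      rw [abs_le]
      constructor <;> linarith
    have : |I (f + g) - (I f + I g)| ≤ 0 := by
      refine le_of_forall_pos_le_add fun ε hε => ?_
      have := key (ε / 2) (by linarith)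
      linarith
    exact sub_eq_zero.1 (abs_nonpos_iff.1 this)
  · rw [← Jconst C]
    exact leJ hf h
  · change sSup _ = sSup _
    congr 1
    ext c
    constructor
    · rintro ⟨s, hs, rfl⟩
      refine ⟨s.comp (σ⁻¹ : Equiv.Perm X) measurable_from_top, fun x => ?_, ?_⟩
      · simpa using hs (σ⁻¹ x)
      · refine Jinv σ⁻¹ (fun S => ?_) s
        rw [← hσ, ← Set.image_comp, ← Equiv.Perm.coe_mul, mul_inv_cancel]
        simp
    · rintro ⟨s, hs, rfl⟩
      exact ⟨s.comp σ measurable_from_top, fun x => hs (σ x), Jinv σ hσ s⟩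

end Integration

lemma AmenableGroup.exists_functionalMean {G : Type*} [Group G] (hG : AmenableGroup G) :
    ∃ M : FunctionalMean G, ∀ g : G, M.IsInvariant (MulAction.toPermHom G G g) := by
  obtain ⟨μ, h0, h1, hadd, hinv⟩ := hG
  obtain ⟨M, hM⟩ := _root_.exists_functionalMean h0 h1 hadd
  exact ⟨M, fun g => hM _ (hinv g)⟩

open Filter Topology in
lemma exists_functionalMean_int :
    ∃ M : FunctionalMean ℤ, M.IsInvariant (Equiv.addRight 1) ∧
      ∀ f : ℤ → ℝ, (∀ n, n ≠ 0 → f n = 0) → M f = 0 := by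
  let a : (ℤ → ℝ) → ℕ → ℝ := fun f N => (∑ k ∈ Finset.range N, f k) / N
  have abd : ∀ {f : ℤ → ℝ} {C : ℝ}, 0 ≤ C → (∀ n, |f n| ≤ C) → ∀ N, |a f N| ≤ C := by
    intro f C hC h N
    rcases Nat.eq_zero_or_pos N with rfl | hN
    · simpa [a] using hC
    · rw [abs_div, Nat.abs_cast, div_le_iff₀ (by positivity)]
      calc |∑ k ∈ Finset.range N, f k| ≤ ∑ k ∈ Finset.range N, |f k| :=
            Finset.abs_sum_le_sum_abs _ _
        _ ≤ ∑ k ∈ Finset.range N, C := Finset.sum_le_sum fun k _ => h k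
        _ = C * N := by simp [mul_comm]
  have hlim : ∀ {f : ℤ → ℝ}, IsBoundedFun f →
      ∃ l, Tendsto (a f) (hyperfilter ℕ) (𝓝 l) := by
    rintro f ⟨C, hC⟩
    have hC0 : 0 ≤ C := (abs_nonneg _).trans (hC 0)
    obtain ⟨l, -, hl⟩ := (isCompact_Icc (a := -C) (b := C)).ultrafilter_le_nhds
      ((hyperfilter ℕ).map (a f)) (by
        rw [le_principal_iff]
        exact Filter.mem_map.2 (Filter.univ_mem' fun N => abs_le.1 (abd hC0 hC N)))
    exact ⟨l, hl⟩
  let L : (ℤ → ℝ) → ℝ := fun f => limUnder (hyperfilter ℕ : Filter ℕ) (a f)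
  have hL : ∀ {f : ℤ → ℝ}, IsBoundedFun f → Tendsto (a f) (hyperfilter ℕ) (𝓝 (L f)) :=
    fun hf => tendsto_nhds_limUnder (hlim hf)
  have hinf : Tendsto (fun N : ℕ => (N : ℝ)) (hyperfilter ℕ) atTop :=
    tendsto_natCast_atTop_atTop.mono_left Nat.hyperfilter_le_atTop
  refine ⟨⟨L, fun {f g} hf hg => ?_, fun {f C} hf h => ?_⟩, fun f hf => ?_, fun f hf => ?_⟩
  · refine tendsto_nhds_unique (hL (hf.add hg)) (((hL hf).add (hL hg)).congr fun N => ?_)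
    simp [a, Finset.sum_add_distrib, add_div]
  · refine le_of_tendsto (hL hf) ?_
    filter_upwards [hinf.eventually_gt_atTop 0] with N hN
    rw [div_le_iff₀ hN]
    calc ∑ k ∈ Finset.range N, f k ≤ ∑ k ∈ Finset.range N, C := Finset.sum_le_sum fun k _ => h k
      _ = C * N := by simp [mul_comm]
  · obtain ⟨C, hC⟩ := id hf
    have hd : Tendsto (fun N : ℕ => (f N - f 0) / N) (hyperfilter ℕ) (𝓝 0) := by
      refine squeeze_zero_norm (a := fun N : ℕ => (2 * C) / N) (fun N => ?_)
        (hinf.const_div_atTop (2 * C))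
      rw [Real.norm_eq_abs, abs_div, Nat.abs_cast]
      refine div_le_div_of_nonneg_right ?_ N.cast_nonneg
      have := abs_sub (f N) (f 0)
      linarith [hC N, hC 0]
    refine tendsto_nhds_unique (hL (hf.comp _)) ?_
    have := (hL hf).add hd
    rw [add_zero] at this
    refine this.congr fun N => ?_
    simp only [a]
    rw [← add_div]
    congr 1
    have h1 := Finset.sum_range_succ (fun k : ℕ => f k) N
    have h2 := Finset.sum_range_succ' (fun k : ℕ => f k) N
    simp only [Function.comp, Equiv.coe_addRight]
    push_cast at h1 h2
    linarith
  · have hb : IsBoundedFun f := ⟨|f 0|, fun n => by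
      by_cases hn : n = 0
      · rw [hn]
      · rw [hf n hn, abs_zero]; exact abs_nonneg _⟩
    refine tendsto_nhds_unique (hL hb) ((hinf.const_div_atTop (f 0)).congr' ?_)
    filter_upwards [hinf.eventually_gt_atTop 0] with N hN
    simp only [a]
    congr 1
    rw [Finset.sum_eq_single 0]
    · simp
    · intro k _ hk
      exact hf k (by exact_mod_cast hk)
    · intro h
      simp at h
      simp [h] at hN

namespace FunctionalMean

variable {X Y : Type*} {M : FunctionalMean X} {N : FunctionalMean Y}

lemma IsInvariant.prod_left {σ : Equiv.Perm X} (hσ : M.IsInvariant σ) (N : FunctionalMean Y) :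
    (M.prod N).IsInvariant (σ.prodCongr (Equiv.refl Y)) := fun _ hf =>
  hσ _ (N.isBoundedFun_apply hf)

/-- A permutation acting fibrewise by permutations preserving the second mean preserves the
iterated mean. -/
lemma IsInvariant.prod_of_fiber (M : FunctionalMean X) {σ : Equiv.Perm (X × Y)}
    {τ : X → Equiv.Perm Y} (hσ : ∀ x y, σ (x, y) = (x, τ x y)) (hτ : ∀ x, N.IsInvariant (τ x)) :
    (M.prod N).IsInvariant σ := fun f hf => by
  change M _ = M _
  congr 1
  ext x
  refine Eq.trans ?_ (hτ x _ (hf.comp (Prod.mk x)))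
  congr 1
  ext y
  simp [hσ]

end FunctionalMean

section Base

variable {A G H U V : Type} [Group G] [Group H]

lemma exists_transversal [Group A] [Countable G] (iG : A →* G) (hiG : Function.Injective iG) :
    ∃ (U : Type) (_ : Countable U) (e : G ≃ A × U),
      ∀ a g, e (iG a * g) = (a * (e g).1, (e g).2) := by
  let U := Quotient (QuotientGroup.rightRel iG.range)
  have hmk : ∀ (a : A) (g : G), (Quotient.mk _ (iG a * g) : U) = Quotient.mk _ g := fun a g =>
    Quotient.sound (QuotientGroup.rightRel_apply.2 ⟨a⁻¹, by simp⟩)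
  have hout : ∀ g : G, ∃ a : A, iG a * (Quotient.mk _ g : U).out = g := fun g => by
    obtain ⟨a, ha⟩ := QuotientGroup.rightRel_apply.1
      (Quotient.exact (Quotient.out_eq (Quotient.mk _ g : U)))
    exact ⟨a, by rw [ha]; group⟩
  choose c hc using hout
  have huniq : ∀ a (q : U), c (iG a * q.out) = a := fun a q => by
    have := hc (iG a * q.out)
    rw [hmk, Quotient.out_eq] at this
    exact hiG (mul_right_cancel this)
  let e : G ≃ A × U :=
    { toFun := fun g => (c g, Quotient.mk _ g)
      invFun := fun x => iG x.1 * x.2.out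
      left_inv := hc
      right_inv := fun x => by
        ext
        · exact huniq x.1 x.2
        · exact (hmk _ _).trans (Quotient.out_eq _) }
  refine ⟨U, inferInstanceAs (Countable (Quotient _)), e, fun a g => ?_⟩
  refine Prod.ext (hiG ?_) (hmk a g)
  have h1 := hc (iG a * g)
  rw [hmk] at h1
  apply mul_right_cancel (b := (Quotient.mk _ g : U).out)
  change iG (c (iG a * g)) * _ = iG (a * c g) * _
  rw [h1, map_mul, mul_assoc, hc]

/-- The action of `G` on `A × U × V` obtained from left translation along `G ≃ A × U`. -/
def firstAction (e : G ≃ A × U) (V : Type) : G →* Equiv.Perm (A × U × V) :=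
  MonoidHom.toHomPerm
    { toFun := fun g x =>
        ((e (g * e.symm (x.1, x.2.1))).1, (e (g * e.symm (x.1, x.2.1))).2, x.2.2)
      map_one' := by funext x; simp [Function.End.one_def]
      map_mul' := fun g g' => by
        funext x
        change _ = (Function.comp _ _) x
        simp [mul_assoc] }

/-- The action of `H` on `A × U × V` obtained from left translation along `H ≃ A × V`. -/
def secondAction (e : H ≃ A × V) (U : Type) : H →* Equiv.Perm (A × U × V) :=
  MonoidHom.toHomPerm
    { toFun := fun h x =>
        ((e (h * e.symm (x.1, x.2.2))).1, x.2.1, (e (h * e.symm (x.1, x.2.2))).2)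
      map_one' := by funext x; simp [Function.End.one_def]
      map_mul' := fun g g' => by
        funext x
        change _ = (Function.comp _ _) x
        simp [mul_assoc] }

lemma firstAction_apply (e : G ≃ A × U) (g : G) (a : A) (u : U) (v : V) :
    firstAction e V g (a, u, v) =
      ((e (g * e.symm (a, u))).1, (e (g * e.symm (a, u))).2, v) := rfl

lemma secondAction_apply (e : H ≃ A × V) (h : H) (a : A) (u : U) (v : V) :
    secondAction e U h (a, u, v) =
      ((e (h * e.symm (a, v))).1, u, (e (h * e.symm (a, v))).2) := rfl

lemma exists_firstAction_eq (e : G ≃ A × U) (a a' : A) (u u' : U) (v : V) :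
    ∃ g, firstAction e V g (a, u, v) = (a', u', v) :=
  ⟨e.symm (a', u') * (e.symm (a, u))⁻¹, by
    rw [firstAction_apply]
    simp⟩

lemma exists_secondAction_eq (e : H ≃ A × V) (a a' : A) (u : U) (v v' : V) :
    ∃ h, secondAction e U h (a, u, v) = (a', u, v') :=
  ⟨e.symm (a', v') * (e.symm (a, v))⁻¹, by
    rw [secondAction_apply]
    simp⟩

lemma mul_symm_of_equivariant [Group A] {iG : A →* G} {e : G ≃ A × U}
    (he : ∀ a g, e (iG a * g) = (a * (e g).1, (e g).2)) (b a : A) (u : U) :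
    iG b * e.symm (a, u) = e.symm (b * a, u) := by
  rw [Equiv.eq_symm_apply, he]
  simp

lemma firstAction_base [Group A] {iG : A →* G} {e : G ≃ A × U}
    (he : ∀ a g, e (iG a * g) = (a * (e g).1, (e g).2)) (b a : A) (u : U) (v : V) :
    firstAction e V (iG b) (a, u, v) = (b * a, u, v) := by
  simp [firstAction_apply, mul_symm_of_equivariant he]

lemma secondAction_base [Group A] {iH : A →* H} {e : H ≃ A × V}
    (he : ∀ a h, e (iH a * h) = (a * (e h).1, (e h).2)) (b a : A) (u : U) (v : V) :
    secondAction e U (iH b) (a, u, v) = (b * a, u, v) := by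
  simp [secondAction_apply, mul_symm_of_equivariant he]

/-- Both actions on `A × U × V` preserve a common mean. -/
lemma exists_common_mean [Group A] [Finite A] (hG : AmenableGroup G) (hH : AmenableGroup H)
    {iG : A →* G} {iH : A →* H} {eG : G ≃ A × U} {eH : H ≃ A × V}
    (heG : ∀ a g, eG (iG a * g) = (a * (eG g).1, (eG g).2))
    (heH : ∀ a h, eH (iH a * h) = (a * (eH h).1, (eH h).2)) :
    ∃ m : FunctionalMean (A × U × V), (∀ g, m.IsInvariant (firstAction eG V g)) ∧
      ∀ h, m.IsInvariant (secondAction eH U h) := by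
  have := Fintype.ofFinite A
  obtain ⟨M, hM⟩ := hG.exists_functionalMean
  obtain ⟨N, hN⟩ := hH.exists_functionalMean
  let K := M.prod N
  let p : G × H → A × U × V := fun x => ((eG x.1).1, (eG x.1).2, (eH x.2).2)
  let q : G × H → A × U × V := fun x => ((eH x.2).1, (eG x.1).2, (eH x.2).2)
  have hKG : ∀ g, K.IsInvariant ((MulAction.toPermHom G G g).prodCongr (Equiv.refl H)) :=
    fun g => (hM g).prod_left N
  have hKH : ∀ h, K.IsInvariant ((Equiv.refl G).prodCongr (MulAction.toPermHom H H h)) :=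
    fun h => FunctionalMean.IsInvariant.prod_of_fiber M (τ := fun _ => MulAction.toPermHom H H h)
      (fun _ _ => rfl) fun _ => hN h
  have hpq : ∀ f, IsBoundedFun f → K (f ∘ p) = K (f ∘ q) := by
    intro f hf
    let t : A → A × U × V → A × U × V := fun c x => (c * x.1, x.2)
    have h1 : ∀ c, K ((f ∘ t c) ∘ p) = K (f ∘ p) := fun c => by
      rw [← hKG (iG c) _ (hf.comp p)]
      congr 1
      ext x
      simp [t, p, heG]
    have h2 : ∀ c, K ((f ∘ t c) ∘ q) = K (f ∘ q) := fun c => by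
      rw [← hKH (iH c) _ (hf.comp q)]
      congr 1
      ext x
      simp [t, q, heH]
    have h3 : ∑ c, ((f ∘ t c) ∘ p) = ∑ c, ((f ∘ t c) ∘ q) := by
      ext x
      simp only [Finset.sum_apply, Function.comp, t, p, q]
      exact (Equiv.sum_comp (Equiv.mulRight (eG x.1).1)
          fun c => f (c, (eG x.1).2, (eH x.2).2)).trans
        (Equiv.sum_comp (Equiv.mulRight (eH x.2).1) fun c => f (c, (eG x.1).2, (eH x.2).2)).symm
    have h4 := congrArg K.toFun h3
    rw [K.map_sum _ fun c => (hf.comp _).comp _, K.map_sum _ fun c => (hf.comp _).comp _] at h4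
    simp only [h1, h2, Finset.sum_const, nsmul_eq_mul] at h4
    refine mul_left_cancel₀ ?_ h4
    simp [Finset.card_univ]
  refine ⟨K.map p, fun g f hf => ?_, fun h f hf => ?_⟩
  · change K _ = K _
    rw [← hKG g _ (hf.comp p)]
    congr 1
    ext x
    simp [p, firstAction_apply]
  · change K (_ ∘ p) = K (_ ∘ p)
    rw [hpq _ hf, hpq _ (hf.comp _), ← hKH h _ (hf.comp q)]
    congr 1
    ext x
    simp [q, secondAction_apply]

end Base

namespace IsAmalgamatedProduct

variable {A G H P : Type} [Group A] [Group G] [Group H] [Group P]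
  {iG : A →* G} {iH : A →* H} {jG : G →* P} {jH : H →* P}

lemma symm (hP : IsAmalgamatedProduct iG iH jG jH) : IsAmalgamatedProduct iH iG jH jG :=
  ⟨hP.1.symm, fun L _ fH fG h => by
    obtain ⟨f, hf, hu⟩ := hP.2 L fG fH h.symm
    exact ⟨f, hf.symm, fun f' hf' => hu f' hf'.symm⟩⟩

lemma apply_eq (hP : IsAmalgamatedProduct iG iH jG jH) (a : A) : jG (iG a) = jH (iH a) :=
  DFunLike.congr_fun hP.1 a

lemma hom_ext (hP : IsAmalgamatedProduct iG iH jG jH) {L : Type} [Group L] {f f' : P →* L}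
    (hG : f.comp jG = f'.comp jG) (hH : f.comp jH = f'.comp jH) : f = f' :=
  (hP.2 L (f'.comp jG) (f'.comp jH)
    (by rw [MonoidHom.comp_assoc, hP.1, MonoidHom.comp_assoc])).unique
    ⟨hG, hH⟩ ⟨rfl, rfl⟩

lemma mem_of_forall_mem (hP : IsAmalgamatedProduct iG iH jG jH) (N : Subgroup P)
    (hG : ∀ g, jG g ∈ N) (hH : ∀ h, jH h ∈ N) (p : P) : p ∈ N := by
  obtain ⟨f, ⟨hfG, hfH⟩, -⟩ := hP.2 N (jG.codRestrict N hG) (jH.codRestrict N hH) (by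
    ext a
    exact hP.apply_eq a)
  have : N.subtype.comp f = MonoidHom.id P := hP.hom_ext
    (by rw [MonoidHom.comp_assoc, hfG]; rfl) (by rw [MonoidHom.comp_assoc, hfH]; rfl)
  rw [← MonoidHom.id_apply (M := P) p, ← this]
  exact (f p).2

lemma countable [Countable G] [Countable H] (hP : IsAmalgamatedProduct iG iH jG jH) :
    Countable P := by
  have : Countable (Monoid.Coprod G H) := Function.Surjective.countable Quot.mk_surjective
  refine Function.Surjective.countable (f := Monoid.Coprod.lift jG jH) fun p => ?_
  exact hP.mem_of_forall_mem (Monoid.Coprod.lift jG jH).range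
    (fun g => ⟨.inl g, by simp⟩) (fun h => ⟨.inr h, by simp⟩) p

/-- Two actions which agree on the amalgamated subgroup give an action of the amalgam. -/
lemma exists_action (hP : IsAmalgamatedProduct iG iH jG jH) {X : Type}
    (φG : G →* Equiv.Perm X) (φH : H →* Equiv.Perm X) (h : ∀ a, φG (iG a) = φH (iH a)) :
    ∃ ψ : P →* Equiv.Perm X, (∀ g, ψ (jG g) = φG g) ∧ ∀ h, ψ (jH h) = φH h := by
  obtain ⟨ψ, ⟨h1, h2⟩, -⟩ := hP.2 (Equiv.Perm X) φG φH (MonoidHom.ext h)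
  exact ⟨ψ, DFunLike.congr_fun h1, DFunLike.congr_fun h2⟩

/-- Conjugating the action of the second factor by a permutation commuting with the amalgamated
subgroup. -/
lemma exists_twist (hP : IsAmalgamatedProduct iG iH jG jH) {X : Type} (ψ : P →* Equiv.Perm X)
    (τ : Equiv.Perm X) (hτ : ∀ a x, τ (ψ (jG (iG a)) x) = ψ (jG (iG a)) (τ x)) :
    ∃ ψ' : P →* Equiv.Perm X, (∀ g, ψ' (jG g) = ψ (jG g)) ∧
      ∀ h, ψ' (jH h) = τ * ψ (jH h) * τ⁻¹ := by
  refine hP.exists_action (ψ.comp jG) ((MulAut.conj τ).toMonoidHom.comp (ψ.comp jH)) fun a => ?_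
  simp only [MonoidHom.comp_apply, MulEquiv.coe_toMonoidHom, MulAut.conj_apply, ← hP.apply_eq,
    eq_mul_inv_iff_mul_eq]
  exact Equiv.ext fun x => (hτ a x).symm

lemma isInvariant (hP : IsAmalgamatedProduct iG iH jG jH) {X : Type} {ψ : P →* Equiv.Perm X}
    {M : FunctionalMean X} (hG : ∀ g, M.IsInvariant (ψ (jG g)))
    (hH : ∀ h, M.IsInvariant (ψ (jH h))) (p : P) : M.IsInvariant (ψ p) :=
  hP.mem_of_forall_mem (M.stabilizer.comap ψ) hG hH p

/-- A set stable under both factors is stable under the amalgam. -/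
lemma mem_of_stable (hP : IsAmalgamatedProduct iG iH jG jH) {X : Type} (ψ : P →* Equiv.Perm X)
    {W : Set X} (hG : ∀ g, ∀ x ∈ W, ψ (jG g) x ∈ W) (hH : ∀ h, ∀ x ∈ W, ψ (jH h) x ∈ W)
    (p : P) {x : X} (hx : x ∈ W) : ψ p x ∈ W := by
  let N : Subgroup P :=
    { carrier := {p | ∀ x, x ∈ W ↔ ψ p x ∈ W}
      mul_mem' := fun {p q} hp hq x => by
        rw [hq, hp, map_mul, Equiv.Perm.mul_apply]
      one_mem' := fun x => by simp
      inv_mem' := fun {p} hp x => by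
        rw [hp (ψ p⁻¹ x), ← Equiv.Perm.mul_apply, ← map_mul]
        simp }
  have key : p ∈ N := hP.mem_of_forall_mem N
    (fun g x => ⟨hG g x, fun h => by simpa using hG g⁻¹ _ h⟩)
    (fun h x => ⟨hH h x, fun hx => by simpa using hH h⁻¹ _ hx⟩) p
  exact (key x).1 hx

/-- If one of the two embeddings is onto, the amalgam is the other factor. -/
lemma inClassA_of_surjective [Countable H] (hP : IsAmalgamatedProduct iG iH jG jH)
    (hH : AmenableGroup H) (hiG : Function.Bijective iG) : InClassA P := by
  let E := MulEquiv.ofBijective iG hiG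
  have hE : ∀ a, E.symm (iG a) = a := E.symm_apply_apply
  obtain ⟨r, ⟨hrG, hrH⟩, -⟩ := hP.2 H (iH.comp E.symm.toMonoidHom) (MonoidHom.id H) (by
    ext a
    simp [hE])
  have hr : jH.comp r = MonoidHom.id P := hP.hom_ext (by
    rw [MonoidHom.comp_assoc, hrG]
    ext g
    obtain ⟨a, rfl⟩ := hiG.2 g
    simp [hE, hP.apply_eq]) (by rw [MonoidHom.comp_assoc, hrH]; rfl)
  have hinj : Function.Injective r := fun x y h => by
    rw [← MonoidHom.id_apply (M := P) x, ← MonoidHom.id_apply (M := P) y, ← hr]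
    exact congrArg jH h
  obtain ⟨μ, h0, h1, hadd, hinv⟩ := hH
  refine ⟨H, inferInstance, (MulAction.toPermHom H H).comp r, ?_, fun x y => ?_, μ, h0, h1, hadd,
    fun p S => hinv (r p) S⟩
  · exact MulAction.toPerm_injective.comp hinj
  · refine ⟨jH (y * x⁻¹), ?_⟩
    have : r (jH (y * x⁻¹)) = y * x⁻¹ := DFunLike.congr_fun hrH _
    rw [MonoidHom.comp_apply, this]
    simp

end IsAmalgamatedProduct

namespace IsAmalgamatedProduct

variable {A G H P : Type} [Group A] [Group G] [Group H] [Group P]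
  {iG : A →* G} {iH : A →* H} {jG : G →* P} {jH : H →* P}

/-- If the action on `Y` of the second factor is changed by conjugating with `τ`, then an
element of `P` acts in the same way as before on all but finitely many points of a subset on
which `P` acts freely, provided `τ` moves only finitely many of them. -/
lemma finite_ne_of_twist (hP : IsAmalgamatedProduct iG iH jG jH) {X : Type}
    {ψ ψ' : P →* Equiv.Perm (X ⊕ P)} {τ : Equiv.Perm (X ⊕ P)}
    (hψ : ∀ p q, ψ p (.inr q) = .inr (p * q)) (hG : ∀ g, ψ' (jG g) = ψ (jG g))
    (hH : ∀ h, ψ' (jH h) = τ * ψ (jH h) * τ⁻¹) (hτ : {q | τ (.inr q) ≠ .inr q}.Finite) (p : P) :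
    {q | ψ' p (.inr q) ≠ .inr (p * q)}.Finite := by
  let N : Subgroup P :=
    { carrier := {p | {q | ψ' p (.inr q) ≠ .inr (p * q)}.Finite}
      mul_mem' := fun {p p'} hp hp' => by
        refine (hp'.union (hp.preimage (f := (p' * ·)) (mul_right_injective p').injOn)).subset ?_
        intro q hq
        by_contra hcon
        simp only [Set.mem_union, Set.mem_ofPred_eq, Set.mem_preimage, not_or, not_not] at hcon
        apply hq
        rw [map_mul, Equiv.Perm.mul_apply, hcon.1, hcon.2, mul_assoc]
      one_mem' := by simp
      inv_mem' := fun {p} hp => by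
        refine (hp.preimage (f := (p⁻¹ * ·)) (mul_right_injective p⁻¹).injOn).subset ?_
        intro q hq
        by_contra hcon
        simp only [Set.mem_ofPred_eq, Set.mem_preimage, not_not, mul_inv_cancel_left] at hcon
        apply hq
        rw [map_inv, Equiv.Perm.inv_eq_iff_eq, hcon] }
  refine hP.mem_of_forall_mem N (fun g => ?_) (fun h => ?_) p
  · change Set.Finite _
    simp [hG, hψ]
  · refine (hτ.union (hτ.preimage (f := (jH h * ·)) (mul_right_injective (jH h)).injOn)).subset ?_
    intro q hq
    by_contra hcon
    simp only [Set.mem_union, Set.mem_ofPred_eq, Set.mem_preimage, not_or, not_not] at hcon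
    apply hq
    have h1 : τ⁻¹ (.inr q) = .inr q := by rw [Equiv.Perm.inv_eq_iff_eq, hcon.1]
    rw [hH, Equiv.Perm.mul_apply, Equiv.Perm.mul_apply, h1, hψ, hcon.2]

/-- A transitive amenable action with a point whose orbit under the amalgamated subgroup is null
and lies on a closed path can be joined with the regular action to get a faithful action. -/
lemma inClassA_of_loop [Countable P] [Infinite P] [Finite A]
    (hP : IsAmalgamatedProduct iG iH jG jH)
    {X : Type} [Countable X] (ψ : P →* Equiv.Perm X) (M : FunctionalMean X)
    (hM : ∀ p, M.IsInvariant (ψ p)) (x₀ : X) (htrans : ∀ x, ∃ p, ψ p x₀ = x)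
    (hfree : ∀ a, ψ (jG (iG a)) x₀ = x₀ → a = 1)
    (hnull : ∀ f, IsBoundedFun f → (∀ x, (∀ a, x ≠ ψ (jG (iG a)) x₀) → f x = 0) → M f = 0)
    (g₁ : G) (h₁ : H) (g₂ : G) (h₂ : H)
    (hl₁ : ∀ a, ψ (jG g₁) x₀ ≠ ψ (jG (iG a)) x₀)
    (hl₂ : ∀ a, ψ (jH h₁) (ψ (jG g₁) x₀) ≠ ψ (jG (iG a)) x₀)
    (hl₃ : ∀ a, ψ (jG g₂) (ψ (jH h₁) (ψ (jG g₁) x₀)) ≠ ψ (jG (iG a)) x₀)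
    (hl₄ : ψ (jH h₂) (ψ (jG g₂) (ψ (jH h₁) (ψ (jG g₁) x₀))) = x₀) : InClassA P := by
  let k : A →* P := jG.comp iG
  have hkinj : Function.Injective k := (injective_iff_map_eq_one k).2 fun a ha =>
    hfree a (by change ψ (k a) x₀ = x₀; simp [ha])
  let o : A → X := fun a => ψ (k a) x₀
  have hoinj : Function.Injective o := fun a b hab => by
    have : ψ (k (b⁻¹ * a)) x₀ = x₀ := by
      rw [map_mul, map_mul, Equiv.Perm.mul_apply, map_inv, map_inv, Equiv.Perm.inv_eq_iff_eq]
      exact hab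
    exact (inv_mul_eq_one.1 (hfree _ this)).symm
  let ι : A ⊕ A ↪ X ⊕ P := ⟨Sum.map o k, hoinj.sumMap hkinj⟩
  let τ : Equiv.Perm (X ⊕ P) := Equiv.Perm.viaEmbedding (Equiv.sumComm A A) ι
  have τo : ∀ a, τ (.inl (o a)) = .inr (k a) := fun a =>
    Equiv.Perm.viaEmbedding_apply (Equiv.sumComm A A) ι (.inl a)
  have τk : ∀ a, τ (.inr (k a)) = .inl (o a) := fun a =>
    Equiv.Perm.viaEmbedding_apply (Equiv.sumComm A A) ι (.inr a)
  have τne : ∀ y, y ∉ Set.range ι → τ y = y := fun y hy =>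
    Equiv.Perm.viaEmbedding_apply_of_notMem (Equiv.sumComm A A) ι y hy
  have τrange : ∀ y, y ∈ Set.range ι → τ y ∈ Set.range ι := by
    rintro _ ⟨b, rfl⟩
    exact ⟨_, (Equiv.Perm.viaEmbedding_apply (Equiv.sumComm A A) ι b).symm⟩
  let Ψ : P →* Equiv.Perm (X ⊕ P) :=
    (Equiv.Perm.sumCongrHom X P).comp (ψ.prod (MulAction.toPermHom P P))
  have Ψl : ∀ p x, Ψ p (.inl x) = .inl (ψ p x) := fun _ _ => rfl
  have Ψr : ∀ p q, Ψ p (.inr q) = .inr (p * q) := fun _ _ => rfl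
  have Ψι : ∀ a b, Ψ (k a) (ι b) = ι (b.map (a * ·) (a * ·)) := by
    rintro a (b | b)
    · change Sum.inl (ψ (k a) (ψ (k b) x₀)) = Sum.inl (ψ (k (a * b)) x₀)
      rw [map_mul, map_mul, Equiv.Perm.mul_apply]
    · change Sum.inr (k a * k b) = Sum.inr (k (a * b))
      rw [map_mul]
  have Ψτ : ∀ a y, τ (Ψ (jG (iG a)) y) = Ψ (jG (iG a)) (τ y) := by
    intro a y
    change τ (Ψ (k a) y) = Ψ (k a) (τ y)
    by_cases hy : y ∈ Set.range ι
    · obtain ⟨b, rfl⟩ := hy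
      rw [Ψι]
      simp only [τ, Equiv.Perm.viaEmbedding_apply, Ψι]
      rcases b with b | b <;> rfl
    · rw [τne y hy, τne]
      rintro ⟨b, hb⟩
      refine hy ⟨b.map (a⁻¹ * ·) (a⁻¹ * ·), ?_⟩
      rw [← Ψι, hb, ← Equiv.Perm.mul_apply, ← map_mul, ← map_mul]
      simp
  obtain ⟨Ψ', hG', hH'⟩ := hP.exists_twist Ψ τ Ψτ
  have hfin : ∀ p, {q | Ψ' p (.inr q) ≠ .inr (p * q)}.Finite :=
    hP.finite_ne_of_twist Ψr hG' hH' ((Set.finite_range k).subset fun q hq => by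
      by_contra hcon
      refine hq (τne _ ?_)
      rintro ⟨b | b, hb⟩
      · exact Sum.inl_ne_inr hb
      · exact hcon ⟨b, Sum.inr_injective hb⟩)
  refine ⟨X ⊕ P, inferInstance, Ψ', (injective_iff_map_eq_one Ψ').2 fun p hp => ?_, ?_, ?_⟩
  · obtain ⟨q, hq⟩ := (hfin p).infinite_compl.nonempty
    simp only [hp, Set.mem_compl_iff, Set.mem_ofPred_eq, not_not, Equiv.Perm.one_apply] at hq
    exact right_eq_mul.1 (Sum.inr_injective hq)
  · have hGap : ∀ g y, Ψ' (jG g) y = Ψ (jG g) y := fun g y => by rw [hG']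
    have hHap : ∀ h y, Ψ' (jH h) (τ y) = τ (Ψ (jH h) y) := fun h y => by simp [hH']
    have hloop : ∃ p, Ψ' p (.inl x₀) = .inr 1 := by
      refine ⟨jH h₂ * jG g₂ * jH h₁ * jG g₁, ?_⟩
      have hnot : ∀ {x}, (∀ a, x ≠ ψ (jG (iG a)) x₀) → τ (.inl x) = .inl x := by
        refine fun {x} hx => τne _ ?_
        rintro ⟨b | b, hb⟩
        · exact hx b (Sum.inl_injective hb).symm
        · exact Sum.inr_ne_inl hb
      have e1 := hHap h₁ (.inl (ψ (jG g₁) x₀))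
      rw [hnot hl₁, Ψl, hnot hl₂] at e1
      have e2 := hHap h₂ (.inl (ψ (jG g₂) (ψ (jH h₁) (ψ (jG g₁) x₀))))
      rw [hnot hl₃, Ψl, hl₄] at e2
      simp only [map_mul, Equiv.Perm.mul_apply, hGap, Ψl, e1, e2]
      simpa [o] using τo 1
    let W : Set (X ⊕ P) := {y | ∃ p, Ψ' p (.inl x₀) = y}
    have W' : ∀ p, ∀ y ∈ W, Ψ' p y ∈ W := by
      rintro p _ ⟨q, rfl⟩
      exact ⟨p * q, by simp⟩
    have hx₀ : .inl x₀ ∈ W := ⟨1, by simp⟩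
    have h1 : .inr 1 ∈ W := hloop
    have hι : ∀ y ∈ Set.range ι, y ∈ W := by
      rintro _ ⟨b | b, rfl⟩
      · have := W' (k b) _ hx₀
        rwa [show Ψ' (k b) = Ψ (k b) from hG' _] at this
      · have := W' (k b) _ h1
        rw [show Ψ' (k b) = Ψ (k b) from hG' _, Ψr, mul_one] at this
        exact this
    have hstable : ∀ p, ∀ y ∈ W, Ψ p y ∈ W := by
      refine fun p y hy => hP.mem_of_stable Ψ (fun g y hy => ?_) (fun h y hy => ?_) p hy
      · rw [← hG']
        exact W' _ _ hy
      · by_cases hr : Ψ (jH h) y ∈ Set.range ι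
        · exact hι _ hr
        · rw [← τne _ hr, ← hHap]
          apply W'
          by_cases hy' : y ∈ Set.range ι
          · exact hι _ (τrange _ hy')
          · rwa [τne _ hy']
    have hall : ∀ y, y ∈ W := by
      rintro (x | q)
      · obtain ⟨p, rfl⟩ := htrans x
        exact hstable p _ hx₀
      · simpa [Ψr] using hstable q _ h1
    intro x y
    obtain ⟨p, rfl⟩ := hall x
    obtain ⟨q, rfl⟩ := hall y
    exact ⟨q * p⁻¹, by simp⟩
  · have hΨ : ∀ p, (M.map (Sum.inl : X → X ⊕ P)).IsInvariant (Ψ p) := fun p f hf =>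
      hM p _ (hf.comp Sum.inl)
    have hτ : (M.map (Sum.inl : X → X ⊕ P)).IsInvariant τ := fun f hf => by
      have hb := (hf.comp τ).comp (Sum.inl : X → X ⊕ P)
      have hb' := hf.comp (Sum.inl : X → X ⊕ P)
      have := hnull _ (hb.add hb'.neg) fun x hx => by
        have : τ (.inl x) = .inl x := τne _ (by
          rintro ⟨b | b, hb⟩
          · exact hx b (Sum.inl_injective hb).symm
          · exact Sum.inr_ne_inl hb)
        simp [this]
      rw [M.map_add hb hb'.neg, M.map_neg hb'] at this
      exact add_neg_eq_zero.1 this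
    refine FunctionalMean.amenableAction (M := M.map Sum.inl) (hP.isInvariant (fun g => ?_)
      fun h => ?_)
    · rw [hG']
      exact hΨ _
    · rw [hH']
      exact (hτ.mul (hΨ _)).mul hτ.inv

end IsAmalgamatedProduct

section Line

open Classical in
/-- The indicator of a point, with integer values. -/
noncomputable def pointIndicator {X : Type*} (x₀ x : X) : ℤ := if x = x₀ then 1 else 0

/-- Shifting fibrewise by an integer depending on the base point. -/
def fiberShift {X : Type*} (s : X → ℤ) : Equiv.Perm (X × ℤ) where
  toFun x := (x.1, x.2 + s x.1)
  invFun x := (x.1, x.2 - s x.1)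
  left_inv x := by simp
  right_inv x := by simp

lemma zpow_addRight_one_apply (k y : ℤ) : (Equiv.addRight (1 : ℤ) ^ k) y = y + k := by
  induction k using Int.induction_on generalizing y with
  | zero => simp
  | succ k ih =>
    rw [zpow_add_one, Equiv.Perm.mul_apply, ih, Equiv.coe_addRight]
    ring
  | pred k ih =>
    rw [zpow_sub_one, Equiv.Perm.mul_apply]
    change (Equiv.addRight (1 : ℤ) ^ (-(k : ℤ))) (y + -1) = _
    rw [ih]
    ring

lemma FunctionalMean.isInvariant_fiberShift {X : Type*} (M : FunctionalMean X)
    {N : FunctionalMean ℤ} (hN : N.IsInvariant (Equiv.addRight 1)) (s : X → ℤ) :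
    (M.prod N).IsInvariant (fiberShift s) := by
  refine FunctionalMean.IsInvariant.prod_of_fiber M (τ := fun x => Equiv.addRight 1 ^ s x)
    (fun x y => ?_) fun x => N.stabilizer.zpow_mem hN (s x)
  rw [zpow_addRight_one_apply]
  rfl

variable {A G H P U V : Type} [Group G] [Group H] [Group P] {jG : G →* P} {jH : H →* P}

/-- An action of the amalgam on `(A × U × V) × ℤ` in which the `A`-orbit of index `(u₀, v₀)` joins
consecutive levels. -/
structure IsLineAction (eG : G ≃ A × U) (eH : H ≃ A × V) (jG : G →* P) (jH : H →* P)
    (u₀ : U) (v₀ : V) (ψ : P →* Equiv.Perm ((A × U × V) × ℤ)) : Prop where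
  first : ∀ g x n, ψ (jG g) (x, n) = (firstAction eG V g x, n)
  second : ∀ h x n, ψ (jH h) (x, n) = (secondAction eH U h x,
    n - pointIndicator (u₀, v₀) x.2 + pointIndicator (u₀, v₀) (secondAction eH U h x).2)

namespace IsLineAction

variable {eG : G ≃ A × U} {eH : H ≃ A × V} {u₀ : U} {v₀ : V}
  {ψ : P →* Equiv.Perm ((A × U × V) × ℤ)}

lemma exists_first (hψ : IsLineAction eG eH jG jH u₀ v₀ ψ) (a a' : A) (u u' : U) (v : V) (n : ℤ) :
    ∃ g, ψ (jG g) ((a, u, v), n) = ((a', u', v), n) := by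
  obtain ⟨g, hg⟩ := exists_firstAction_eq eG a a' u u' v
  exact ⟨g, by rw [hψ.first, hg]⟩

lemma exists_second (hψ : IsLineAction eG eH jG jH u₀ v₀ ψ) (a a' : A) (u : U) (v v' : V)
    {n n' : ℤ} (hn : n' = n - pointIndicator (u₀, v₀) (u, v) + pointIndicator (u₀, v₀) (u, v')) :
    ∃ h, ψ (jH h) ((a, u, v), n) = ((a', u, v'), n') := by
  obtain ⟨h, hh⟩ := exists_secondAction_eq eH a a' u v v'
  exact ⟨h, by rw [hψ.second, hh, hn]⟩

end IsLineAction

variable [Group A] {iG : A →* G} {iH : A →* H}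

lemma IsAmalgamatedProduct.exists_isLineAction [Finite A]
    (hP : IsAmalgamatedProduct iG iH jG jH) (hG : AmenableGroup G) (hH : AmenableGroup H)
    {eG : G ≃ A × U} {eH : H ≃ A × V}
    (heG : ∀ a g, eG (iG a * g) = (a * (eG g).1, (eG g).2))
    (heH : ∀ a h, eH (iH a * h) = (a * (eH h).1, (eH h).2)) (u₀ : U) (v₀ : V) :
    ∃ (ψ : P →* Equiv.Perm ((A × U × V) × ℤ)) (M : FunctionalMean ((A × U × V) × ℤ)),
      IsLineAction eG eH jG jH u₀ v₀ ψ ∧ (∀ p, M.IsInvariant (ψ p)) ∧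
      ∀ f, (∀ x n, n ≠ 0 → f (x, n) = 0) → M f = 0 := by
  obtain ⟨m, hmG, hmH⟩ := exists_common_mean hG hH heG heH
  obtain ⟨N, hN, hN0⟩ := exists_functionalMean_int
  obtain ⟨φ, hφG, hφH⟩ := hP.exists_action (firstAction eG V) (secondAction eH U) fun a => by
    ext ⟨b, u, v⟩ : 1
    rw [firstAction_base heG, secondAction_base heH]
  let Φ : P →* Equiv.Perm ((A × U × V) × ℤ) :=
    { toFun := fun p => (φ p).prodCongr (Equiv.refl ℤ)
      map_one' := by ext x : 1; simp
      map_mul' := fun p q => by ext x : 1; rw [map_mul]; rfl }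
  have hΦ : ∀ p x n, Φ p (x, n) = (φ p x, n) := fun _ _ _ => rfl
  let s : A × U × V → ℤ := fun x => pointIndicator (u₀, v₀) x.2
  obtain ⟨ψ, hψG, hψH⟩ := hP.exists_twist Φ (fiberShift s) fun a ⟨⟨b, u, v⟩, n⟩ => by
    simp only [fiberShift, Equiv.coe_fn_mk, hΦ, hφG, firstAction_base heG, s]
  refine ⟨ψ, m.prod N, ⟨fun g x n => ?_, fun h x n => ?_⟩, ?_, fun f hf => ?_⟩
  · rw [hψG, hΦ, hφG]
  · rw [hψH]
    change fiberShift s (Φ (jH h) (x, n - s x)) = _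
    rw [hΦ, hφH]
    rfl
  · have hinv : ∀ p, (m.prod N).IsInvariant (Φ p) := fun p =>
      (hP.isInvariant (ψ := φ) (M := m) (fun g => hφG g ▸ hmG g) (fun h => hφH h ▸ hmH h)
        p).prod_left N
    have hs := m.isInvariant_fiberShift hN s
    refine hP.isInvariant (fun g => ?_) fun h => ?_
    · rw [hψG]
      exact hinv _
    · rw [hψH]
      exact (hs.mul (hinv _)).mul hs.inv
  · change m (fun x => N fun n => f (x, n)) = 0
    have : (fun x => N fun n => f (x, n)) = 0 := funext fun x => hN0 _ (hf x)
    rw [this]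
    exact m.map_zero

namespace IsLineAction

variable {eG : G ≃ A × U} {eH : H ≃ A × V} {u₀ u₁ : U} {v₀ v₁ : V}
  {ψ : P →* Equiv.Perm ((A × U × V) × ℤ)}

lemma base (hψ : IsLineAction eG eH jG jH u₀ v₀ ψ)
    (heG : ∀ a g, eG (iG a * g) = (a * (eG g).1, (eG g).2)) (b a : A) (u : U) (v : V) (n : ℤ) :
    ψ (jG (iG b)) ((a, u, v), n) = ((b * a, u, v), n) := by
  rw [hψ.first, firstAction_base heG]

lemma exists_eq (hψ : IsLineAction eG eH jG jH u₀ v₀ ψ) (hu : u₁ ≠ u₀) (hv : v₁ ≠ v₀)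
    (x y : (A × U × V) × ℤ) : ∃ p, ψ p x = y := by
  let R : (A × U × V) × ℤ → (A × U × V) × ℤ → Prop := fun x y => ∃ p, ψ p x = y
  have Rsymm : ∀ {x y}, R x y → R y x := by
    rintro x _ ⟨p, rfl⟩
    exact ⟨p⁻¹, by simp⟩
  have Rtrans : ∀ {x y z}, R x y → R y z → R x z := by
    rintro x _ _ ⟨p, rfl⟩ ⟨q, rfl⟩
    exact ⟨q * p, by simp⟩
  have R1 : ∀ a a' u u' v n, R ((a, u, v), n) ((a', u', v), n) := fun a a' u u' v n =>
    let ⟨g, hg⟩ := hψ.exists_first a a' u u' v n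
    ⟨jG g, hg⟩
  have R2 : ∀ a a' v v' n, R ((a, u₁, v), n) ((a', u₁, v'), n) := fun a a' v v' n =>
    let ⟨h, hh⟩ := hψ.exists_second a a' u₁ v v' (n := n) (n' := n) (by
      simp [pointIndicator, hu])
    ⟨jH h, hh⟩
  have R3 : ∀ n, R ((1, u₀, v₀), n) ((1, u₀, v₀), n + 1) := fun n => by
    obtain ⟨h, hh⟩ := hψ.exists_second 1 1 u₀ v₁ v₀ (n := n) (n' := n + 1) (by
      simp [pointIndicator, hv])
    exact Rtrans (R1 1 1 u₀ u₁ v₀ n) (Rtrans (R2 1 1 v₀ v₁ n) (Rtrans (R1 1 1 u₁ u₀ v₁ n)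
      ⟨jH h, hh⟩))
  have R4 : ∀ n, R ((1, u₀, v₀), 0) ((1, u₀, v₀), n) := fun n => by
    induction n using Int.induction_on with
    | zero => exact ⟨1, by simp⟩
    | succ n ih => exact Rtrans ih (R3 _)
    | pred n ih =>
      refine Rtrans ih (Rsymm ?_)
      simpa using R3 (-(n : ℤ) - 1)
  have R5 : ∀ x, R ((1, u₀, v₀), 0) x := fun ⟨⟨a, u, v⟩, n⟩ =>
    Rtrans (R4 n) (Rtrans (R1 1 1 u₀ u₁ v₀ n) (Rtrans (R2 1 1 v₀ v n) (R1 1 a u₁ u v n)))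
  exact Rtrans (Rsymm (R5 x)) (R5 y)

lemma infinite (hψ : IsLineAction eG eH jG jH u₀ v₀ ψ) (hu : u₁ ≠ u₀) (hv : v₁ ≠ v₀) :
    Infinite P :=
  have : Infinite ((A × U × V) × ℤ) :=
    Infinite.of_injective (fun n : ℤ => (((1 : A), u₀, v₀), n)) fun _ _ h => (Prod.ext_iff.1 h).2
  Infinite.of_surjective (fun p => ψ p ((1, u₀, v₀), 0)) (hψ.exists_eq hu hv _)

end IsLineAction

namespace IsAmalgamatedProduct

lemma inClassA_of_three [Countable P] [Finite A] [Countable U] [Countable V]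
    (hP : IsAmalgamatedProduct iG iH jG jH) (hG : AmenableGroup G) (hH : AmenableGroup H)
    {eG : G ≃ A × U} {eH : H ≃ A × V}
    (heG : ∀ a g, eG (iG a * g) = (a * (eG g).1, (eG g).2))
    (heH : ∀ a h, eH (iH a * h) = (a * (eH h).1, (eH h).2)) {u₀ u₁ u₂ : U} {v₀ v₁ : V}
    (hu₁ : u₁ ≠ u₀) (hu₂ : u₂ ≠ u₀) (hu : u₂ ≠ u₁) (hv : v₁ ≠ v₀) : InClassA P := by
  obtain ⟨ψ, M, hψ, hM, hnull⟩ := hP.exists_isLineAction hG hH heG heH u₀ v₀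
  have := hψ.infinite hu₁ hv
  obtain ⟨g₁, hg₁⟩ := hψ.exists_first 1 1 u₁ u₂ v₁ 0
  obtain ⟨h₁, hh₁⟩ := hψ.exists_second 1 1 u₂ v₁ v₀ (n := 0) (n' := 0) (by
    simp [pointIndicator, hu₂])
  obtain ⟨g₂, hg₂⟩ := hψ.exists_first 1 1 u₂ u₁ v₀ 0
  obtain ⟨h₂, hh₂⟩ := hψ.exists_second 1 1 u₁ v₀ v₁ (n := 0) (n' := 0) (by
    simp [pointIndicator, hu₁])
  refine hP.inClassA_of_loop ψ M hM ((1, u₁, v₁), 0) (hψ.exists_eq hu₁ hv _) (fun a ha => ?_)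
    (fun f _ hf => hnull f fun x n hn => hf _ fun a ha => ?_) g₁ h₁ g₂ h₂ ?_ ?_ ?_ ?_
  · rw [hψ.base heG] at ha
    simpa using ha
  · rw [hψ.base heG] at ha
    exact hn (Prod.ext_iff.1 ha).2
  · intro a
    rw [hg₁, hψ.base heG]
    simp [hu]
  · intro a
    rw [hg₁, hh₁, hψ.base heG]
    simp [hu]
  · intro a
    rw [hg₁, hh₁, hg₂, hψ.base heG]
    simp [hv.symm]
  · rw [hg₁, hh₁, hg₂, hh₂]

end IsAmalgamatedProduct

end Line

namespace IsAmalgamatedProduct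

variable {A G H P U V : Type} [Group A] [Group G] [Group H] [Group P]
  {iG : A →* G} {iH : A →* H} {jG : G →* P} {jH : H →* P}

/-- An action with an equivariant map to the regular action is faithful. -/
lemma injective_of_equivariant (hP : IsAmalgamatedProduct iG iH jG jH) {X : Type} [Nonempty X]
    {ψ : P →* Equiv.Perm X} (θ : X → P) (hG : ∀ g x, θ (ψ (jG g) x) = jG g * θ x)
    (hH : ∀ h x, θ (ψ (jH h) x) = jH h * θ x) : Function.Injective ψ := by
  let N : Subgroup P :=
    { carrier := {p | ∀ x, θ (ψ p x) = p * θ x}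
      mul_mem' := fun {p q} hp hq x => by
        rw [map_mul, Equiv.Perm.mul_apply, hp, hq, mul_assoc]
      one_mem' := fun x => by simp
      inv_mem' := fun {p} hp x => by
        rw [eq_inv_mul_iff_mul_eq, ← hp, ← Equiv.Perm.mul_apply, ← map_mul]
        simp }
  have hN : ∀ p x, θ (ψ p x) = p * θ x := hP.mem_of_forall_mem N hG hH
  refine (injective_iff_map_eq_one ψ).2 fun p hp => ?_
  obtain ⟨x⟩ := ‹Nonempty X›
  have := hN p x
  rw [hp, Equiv.Perm.one_apply] at this
  exact right_eq_mul.1 this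

/-- If both factors contain the amalgamated subgroup with index two, the action on the line is
free. -/
lemma inClassA_of_two [Finite A] [Countable U] [Countable V]
    (hP : IsAmalgamatedProduct iG iH jG jH) (hG : AmenableGroup G) (hH : AmenableGroup H)
    {eG : G ≃ A × U} {eH : H ≃ A × V}
    (heG : ∀ a g, eG (iG a * g) = (a * (eG g).1, (eG g).2))
    (heH : ∀ a h, eH (iH a * h) = (a * (eH h).1, (eH h).2)) {u₀ u₁ : U} {v₀ v₁ : V}
    (hu : u₁ ≠ u₀) (hv : v₁ ≠ v₀) (hU : ∀ u, u = u₀ ∨ u = u₁) (hV : ∀ v, v = v₀ ∨ v = v₁) :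
    InClassA P := by
  classical
  obtain ⟨ψ, M, hψ, hM, -⟩ := hP.exists_isLineAction hG hH heG heH u₀ v₀
  refine ⟨(A × U × V) × ℤ, inferInstance, ψ, ?_, hψ.exists_eq hu hv,
    FunctionalMean.amenableAction hM⟩
  let r : U → P := fun u => jG (eG.symm (1, u))
  let s : V → P := fun v => jH (eH.symm (1, v))
  have hr : ∀ a u, jG (eG.symm (a, u)) = jG (iG a) * r u := fun a u => by
    rw [← map_mul, mul_symm_of_equivariant heG, mul_one]
  have hs : ∀ a v, jH (eH.symm (a, v)) = jG (iG a) * s v := fun a v => by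
    rw [hP.apply_eq, ← map_mul, mul_symm_of_equivariant heH, mul_one]
  let t : P := (s v₁)⁻¹ * r u₀ * (r u₁)⁻¹ * s v₁ * (s v₀)⁻¹ * r u₁ * (r u₀)⁻¹ * s v₀
  let d : U → ℤ → P := fun u n =>
    if u = u₀ then t ^ n else (s v₀)⁻¹ * r u₁ * (r u₀)⁻¹ * s v₀ * t ^ (n - 1)
  let c : V → ℤ → P := fun v n =>
    if v = v₀ then (r u₀)⁻¹ * s v₀ * t ^ (n - 1)
    else (r u₁)⁻¹ * s v₁ * (s v₀)⁻¹ * r u₁ * (r u₀)⁻¹ * s v₀ * t ^ (n - 1)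
  have hcd : ∀ u v n, r u * c v n = s v * d u (n - pointIndicator (u₀, v₀) (u, v)) := by
    intro u v n
    have ht : t ^ n = t * t ^ (n - 1) := by rw [← zpow_one_add]; congr 1; ring
    rcases hU u with rfl | rfl <;> rcases hV v with rfl | rfl <;>
      simp [c, d, pointIndicator, hu, hv, mul_assoc]
    rw [ht]
    simp [t, mul_assoc]
  have : Nonempty ((A × U × V) × ℤ) := ⟨((1, u₀, v₀), 0)⟩
  let θ : (A × U × V) × ℤ → P := fun x => jG (eG.symm (x.1.1, x.1.2.1)) * c x.1.2.2 x.2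
  have hθ : ∀ a u v n, θ ((a, u, v), n) =
      jH (eH.symm (a, v)) * d u (n - pointIndicator (u₀, v₀) (u, v)) := fun a u v n => by
    rw [hs, mul_assoc, ← hcd, ← mul_assoc, ← hr]
  refine hP.injective_of_equivariant θ ?_ ?_
  · rintro g ⟨⟨a, u, v⟩, n⟩
    rw [hψ.first, firstAction_apply]
    simp [θ, mul_assoc]
  · rintro h ⟨⟨a, u, v⟩, n⟩
    rw [hψ.second, secondAction_apply, hθ, hθ]
    simp [mul_assoc]

end IsAmalgamatedProduct

/-- A nonsurjective inclusion has at least two cosets. -/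
lemma exists_ne_of_not_surjective {A G U : Type} [Group A] [Group G] {iG : A →* G}
    {e : G ≃ A × U} (he : ∀ a g, e (iG a * g) = (a * (e g).1, (e g).2))
    (hiG : ¬ Function.Surjective iG) : ∃ u, u ≠ (e 1).2 := by
  by_contra! h
  refine hiG fun g => ⟨(e g).1 * (e 1).1⁻¹, e.injective ?_⟩
  rw [← mul_one (iG _), he]
  exact Prod.ext (by simp) (by rw [h (e g).2])

/-- Corollary 2.11 (Moon, arXiv:1003.3998).
Let `G` and `H` be countable amenable groups and `A` a common finite subgroup of `G` and
`H` (given by injective homomorphisms `iG`, `iH`). Then the amalgamated free product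
`G ∗_A H` is in the class `𝒜`. -/
theorem amalgam_of_amenables_over_finite_subgroup_mem_classA
    (G H A : Type) [Group G] [Group H] [Group A]
    [Countable G] [Countable H] [Finite A]
    (hG : AmenableGroup G) (hH : AmenableGroup H)
    (iG : A →* G) (iH : A →* H)
    (hiG : Function.Injective iG) (hiH : Function.Injective iH)
    (P : Type) [Group P] (jG : G →* P) (jH : H →* P)
    (hP : IsAmalgamatedProduct iG iH jG jH) :
    InClassA P := by
  have := hP.countable
  by_cases hsG : Function.Surjective iG
  · exact hP.inClassA_of_surjective hH ⟨hiG, hsG⟩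
  by_cases hsH : Function.Surjective iH
  · exact hP.symm.inClassA_of_surjective hG ⟨hiH, hsH⟩
  obtain ⟨U, _, eG, heG⟩ := exists_transversal iG hiG
  obtain ⟨V, _, eH, heH⟩ := exists_transversal iH hiH
  obtain ⟨u₁, hu₁⟩ := exists_ne_of_not_surjective heG hsG
  obtain ⟨v₁, hv₁⟩ := exists_ne_of_not_surjective heH hsH
  by_cases hU : ∃ u, u ≠ (eG 1).2 ∧ u ≠ u₁
  · obtain ⟨u₂, hu₂, hu⟩ := hU
    exact hP.inClassA_of_three hG hH heG heH hu₁ hu₂ hu hv₁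
  by_cases hV : ∃ v, v ≠ (eH 1).2 ∧ v ≠ v₁
  · obtain ⟨v₂, hv₂, hv⟩ := hV
    exact hP.symm.inClassA_of_three hH hG heH heG hv₁ hv₂ hv hu₁
  refine hP.inClassA_of_two hG hH heG heH hu₁ hv₁ (fun u => ?_) fun v => ?_
  · by_contra! h
    exact hU ⟨u, h⟩
  · by_contra! h
    exact hV ⟨v, h⟩
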